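/- Let g be the harmonic extension to the disc B(x₀,r) ⊂ ℝ² of a function ũ ∈ W^{1,p}(∂B(x₀,r); ℝ²) with p ∈ (1,2]. Then ∫_{B(x₀,r)} |∇g|² dx ≤ C r^{2−2/p} ( ∫_{∂B(x₀,r)} |∂_τ ũ|^p dH¹ )^{2/p} for a constant C = C(p). -/

import Mathlib

open Metric Set MeasureTheory

noncomputable def rot (z : EuclideanSpace ℝ (Fin 2)) : EuclideanSpace ℝ (Fin 2) :=
  (WithLp.equiv 2 (Fin 2 → ℝ)).symm ![-(z 1), z 0]

/-- Unit tangent vector to the circle `sphere x₀ r` at the point `y`. -/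
noncomputable def tangent (x₀ : EuclideanSpace ℝ (Fin 2)) (r : ℝ)
    (y : EuclideanSpace ℝ (Fin 2)) : EuclideanSpace ℝ (Fin 2) :=
  (1 / r) • rot (y - x₀)

/-- The Laplacian of a planar vector field, componentwise. -/
noncomputable def lap (g : EuclideanSpace ℝ (Fin 2) → EuclideanSpace ℝ (Fin 2))
    (y : EuclideanSpace ℝ (Fin 2)) : EuclideanSpace ℝ (Fin 2) :=
  ∑ i : Fin 2, fderiv ℝ (fun z => fderiv ℝ g z (EuclideanSpace.single i 1)) y
    (EuclideanSpace.single i 1)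

section helpers

open scoped ENNReal


open InnerProductSpace in
theorem L2 (G : ℂ → ℝ) (hG : HarmonicContOnCl G (ball 0 1)) (φ' : ℝ → ℝ)
    (hφ : ∀ s, HasDerivAt (fun s => G (circleMap 0 1 s)) (φ' s) s)
    (hi : IntervalIntegrable φ' volume 0 (2 * Real.pi)) (z : ℂ) (hz : z ∈ ball (0:ℂ) 1) :
    ‖fderiv ℝ G z‖ ≤ ∫ s in (0:ℝ)..(2 * Real.pi), |φ' s| * ‖circleMap 0 1 s - z‖⁻¹ := by
  have hcont : ContinuousOn G (sphere 0 1) := hG.continuousOn_ball.mono sphere_subset_closedBall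
  have hci : CircleIntegrable G 0 1 := hcont.circleIntegrable zero_le_one
  have hciC : CircleIntegrable (fun ζ => (G ζ : ℂ)) 0 1 :=
    ContinuousOn.circleIntegrable zero_le_one (Complex.continuous_ofReal.comp_continuousOn hcont)
  set F : ℂ → ℂ := fun w => Real.circleAverage (fun ζ ↦ herglotzRieszKernel 0 w ζ • (G ζ : ℂ)) 0 1 with hF
  have hre : ∀ w ∈ ball (0:ℂ) 1, G w = (F w).re := by
    intro w hw
    rw [hF]
    simp only
    rw [re_circleAverage_herglotzRieszKernel_smul hci hw,
      hG.circleAverage_re_herglotzRieszKernel_smul hw]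
  have hd := hasDerivAt_circleAverage_herglotzRieszKernel_smul hciC hz
  have hne : ∀ s, circleMap 0 1 s - z ≠ 0 := fun s => sub_ne_zero.2 (circleMap_ne_mem_ball hz s)
  set D := Real.circleAverage (fun ζ ↦ (2 * ζ / (ζ - z) ^ 2) • (G ζ : ℂ)) 0 1 with hD
  have h1 : HasFDerivAt G (Complex.reCLM.comp ((ContinuousLinearMap.toSpanSingleton ℂ D).restrictScalars ℝ)) z := by
    have h2 := (Complex.reCLM.hasFDerivAt (x := F z)).comp z (hd.hasFDerivAt.restrictScalars ℝ)
    refine h2.congr_of_eventuallyEq ?_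
    filter_upwards [isOpen_ball.mem_nhds hz] with w hw
    exact hre w hw
  have h3 : ‖fderiv ℝ G z‖ ≤ ‖D‖ := by
    rw [h1.fderiv]
    refine ContinuousLinearMap.opNorm_le_bound _ (norm_nonneg _) fun v => ?_
    simp only [ContinuousLinearMap.comp_apply, ContinuousLinearMap.coe_restrictScalars',
      ContinuousLinearMap.toSpanSingleton_apply]
    refine (Complex.abs_re_le_norm _).trans ?_
    rw [norm_smul, mul_comm]
  have hv : ∀ s : ℝ, HasDerivAt (fun s : ℝ => (circleMap 0 1 s - z)⁻¹)
      (-(circleMap 0 1 s * Complex.I) / (circleMap 0 1 s - z) ^ 2) s := by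
    intro s
    exact ((hasDerivAt_circleMap 0 1 s).sub_const z).fun_inv (hne s)
  have hcv : Continuous (fun s : ℝ => (circleMap 0 1 s - z)⁻¹) :=
    continuous_iff_continuousAt.2 fun s => (hv s).continuousAt
  have hip := intervalIntegral.integral_mul_deriv_eq_deriv_mul (a := 0) (b := 2 * Real.pi)
    (u := fun s => (G (circleMap 0 1 s) : ℂ)) (u' := fun s => (φ' s : ℂ))
    (v := fun s : ℝ => (circleMap 0 1 s - z)⁻¹)
    (v' := fun s : ℝ => -(circleMap 0 1 s * Complex.I) / (circleMap 0 1 s - z) ^ 2)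
    (fun s _ => (hφ s).ofReal_comp) (fun s _ => hv s) ⟨hi.1.ofReal, hi.2.ofReal⟩
    (Continuous.intervalIntegrable (Continuous.div (by fun_prop) (by fun_prop) (fun s => pow_ne_zero _ (hne s))) _ _)
  have h4 : D = (2 * Real.pi)⁻¹ • ((-2 * Complex.I) * ∫ s in (0:ℝ)..(2 * Real.pi), (φ' s : ℂ) * (circleMap 0 1 s - z)⁻¹) := by
    rw [hD, Real.circleAverage_def]
    congr 1
    have h5 : (circleMap 0 1 (2 * Real.pi)) = circleMap 0 1 0 := by
      simpa using (periodic_circleMap 0 1) 0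
    rw [h5, sub_self, zero_sub] at hip
    rw [show (∫ s in (0:ℝ)..(2 * Real.pi), (φ' s : ℂ) * (circleMap 0 1 s - z)⁻¹) = - ∫ s in (0:ℝ)..(2 * Real.pi), (G (circleMap 0 1 s) : ℂ) * (-(circleMap 0 1 s * Complex.I) / (circleMap 0 1 s - z) ^ 2) by rw [hip]; ring]
    rw [mul_neg, ← neg_mul, ← intervalIntegral.integral_const_mul]
    congr 1
    ext s
    have hI := Complex.I_sq
    simp only [smul_eq_mul]
    field_simp [hne s]
    linear_combination (G (circleMap 0 1 s) : ℂ) * hI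
  refine h3.trans ?_
  rw [h4, norm_smul, norm_mul]
  have h6 : ‖∫ s in (0:ℝ)..(2 * Real.pi), (φ' s : ℂ) * (circleMap 0 1 s - z)⁻¹‖ ≤ ∫ s in (0:ℝ)..(2 * Real.pi), |φ' s| * ‖circleMap 0 1 s - z‖⁻¹ := by
    refine (intervalIntegral.norm_integral_le_integral_norm (by positivity)).trans (le_of_eq ?_)
    simp
  set J := ∫ s in (0:ℝ)..(2 * Real.pi), |φ' s| * ‖circleMap 0 1 s - z‖⁻¹ with hJ
  have h7 : ‖(2 * Real.pi)⁻¹‖ * ‖-2 * Complex.I‖ ≤ 1 := by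
    have := Real.pi_gt_three
    simp [abs_of_pos Real.pi_pos]
    have : Real.pi⁻¹ ≤ 1 := inv_le_one_of_one_le₀ (by linarith)
    linarith
  calc _ = (‖(2 * Real.pi)⁻¹‖ * ‖-2 * Complex.I‖) * ‖∫ s in (0:ℝ)..(2 * Real.pi), (φ' s : ℂ) * (circleMap 0 1 s - z)⁻¹‖ := by ring
    _ ≤ 1 * J := by gcongr
    _ = J := one_mul _

theorem L1a (ρ : ℝ) (z : ℂ) (hz : ‖z‖ = ρ) (s : ℝ) :
    1 - ρ ≤ ‖circleMap 0 1 s - z‖ := by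
  have := norm_sub_norm_le (circleMap 0 1 s) z
  simpa [hz] using this

theorem L1b (ρ θ s : ℝ) (h0 : 0 ≤ ρ) :
    |Real.sin ((s - θ) / 2)| ≤ ‖circleMap 0 1 s - ρ * (Real.cos θ + Real.sin θ * Complex.I)‖ := by
  refine abs_le_of_sq_le_sq ?_ (norm_nonneg _)
  rw [← Complex.normSq_eq_norm_sq, Complex.normSq_apply]
  have e1 : (circleMap 0 1 s - ρ * (Real.cos θ + Real.sin θ * Complex.I)).re = Real.cos s - ρ * Real.cos θ := by
    simp [circleMap, Complex.exp_ofReal_mul_I_re, -Complex.ofReal_cos, -Complex.ofReal_sin]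
  have e2 : (circleMap 0 1 s - ρ * (Real.cos θ + Real.sin θ * Complex.I)).im = Real.sin s - ρ * Real.sin θ := by
    simp [circleMap, Complex.exp_ofReal_mul_I_im, -Complex.ofReal_cos, -Complex.ofReal_sin]
  rw [e1, e2]
  have e3 : Real.cos (s - θ) = 1 - 2 * Real.sin ((s-θ)/2)^2 := by
    have := Real.cos_sq' ((s-θ)/2)
    have h2 := Real.cos_two_mul ((s-θ)/2)
    rw [show 2 * ((s-θ)/2) = s - θ by ring] at h2
    rw [h2, this]; ring
  rw [Real.cos_sub] at e3
  have h1 := Real.sin_sq_add_cos_sq s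
  have h2 := Real.sin_sq_add_cos_sq θ
  have h3 := Real.sin_sq_le_one ((s-θ)/2)
  have h4 := sq_nonneg (Real.sin ((s-θ)/2))
  set x := Real.sin ((s-θ)/2)^2
  have : (Real.cos s - ρ * Real.cos θ) * (Real.cos s - ρ * Real.cos θ) + (Real.sin s - ρ * Real.sin θ) * (Real.sin s - ρ * Real.sin θ) = (1-ρ)^2 + 4 * ρ * x := by
    linear_combination h1 + ρ^2*h2 - 2 * ρ * e3
  rw [this]
  nlinarith [mul_nonneg (sq_nonneg (1-ρ)) (sub_nonneg.2 h3), mul_nonneg (mul_nonneg h0 h0) h4, mul_nonneg h0 h4]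

theorem ind_le {α : Type*} {s : Set α} {f g : α → ℝ≥0∞} (h : ∀ x ∈ s, f x ≤ g x) (x : α) :
    s.indicator f x ≤ g x := by
  by_cases hx : x ∈ s
  · rw [indicator_of_mem hx]; exact h x hx
  · rw [indicator_of_notMem hx]; exact zero_le

noncomputable def hk (a t : ℝ) : ℝ≥0∞ := (ENNReal.ofReal |Real.sin (t / 2)|)⁻¹ ^ a

theorem hk_meas (a : ℝ) : Measurable (hk a) := by
  unfold hk; fun_prop

theorem hk_neg (a t : ℝ) : hk a (-t) = hk a t := by
  unfold hk; rw [neg_div, Real.sin_neg, abs_neg]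

theorem hk_sub (a t : ℝ) : hk a (t - 2 * Real.pi) = hk a t := by
  unfold hk
  rw [show (t - 2 * Real.pi) / 2 = t / 2 - Real.pi by ring, Real.sin_sub_pi, abs_neg]

theorem pow_inv_fin (a c : ℝ) (h1 : a < 1) (hc : 0 ≤ c) :
    ∫⁻ t in Ioc 0 c, (ENNReal.ofReal t)⁻¹ ^ a < ∞ := by
  have h := (intervalIntegral.intervalIntegrable_rpow' (a := 0) (b := c) (r := -a) (by linarith))
  rw [intervalIntegrable_iff_integrableOn_Ioc_of_le hc] at h
  refine lt_of_eq_of_lt ?_ h.setLIntegral_lt_top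
  refine setLIntegral_congr_fun measurableSet_Ioc fun t ht => ?_
  rw [← ENNReal.ofReal_rpow_of_pos ht.1, ENNReal.inv_rpow, ENNReal.rpow_neg]

theorem hk_fin0 (a : ℝ) (h0 : 0 ≤ a) (h1 : a < 1) : ∫⁻ t in Ioc 0 Real.pi, hk a t < ∞ := by
  have : ∫⁻ t in Ioc 0 Real.pi, hk a t ≤
      ∫⁻ t in Ioc 0 Real.pi, ENNReal.ofReal Real.pi ^ a * (ENNReal.ofReal t)⁻¹ ^ a := by
    refine setLIntegral_mono (by fun_prop) fun t ht => ?_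
    unfold hk
    rw [← ENNReal.mul_rpow_of_nonneg _ _ h0]
    refine ENNReal.rpow_le_rpow ?_ h0
    have h2 := Real.mul_le_sin (x := t / 2) (by linarith [ht.1]) (by linarith [ht.2])
    have h3 : t / Real.pi ≤ |Real.sin (t / 2)| := by
      refine le_trans (le_of_eq ?_) (h2.trans (le_abs_self _))
      field_simp
    have h4 : 0 < t / Real.pi := div_pos ht.1 Real.pi_pos
    rw [← ENNReal.ofReal_inv_of_pos (h4.trans_le h3), ← ENNReal.ofReal_inv_of_pos ht.1,
      ← ENNReal.ofReal_mul Real.pi_pos.le]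
    refine ENNReal.ofReal_le_ofReal ?_
    rw [← div_eq_mul_inv, ← inv_div t]
    exact inv_anti₀ h4 h3
  refine this.trans_lt ?_
  rw [lintegral_const_mul _ (by fun_prop)]
  exact ENNReal.mul_lt_top (ENNReal.rpow_lt_top_of_nonneg h0 ENNReal.ofReal_ne_top)
    (pow_inv_fin a _ h1 Real.pi_pos.le)

theorem hk_fin (a : ℝ) (h0 : 0 ≤ a) (h1 : a < 1) :
    ∫⁻ t in Ioo (-Real.pi) (3 * Real.pi), hk a t < ∞ := by
  set k : ℝ → ℝ≥0∞ := (Icc 0 Real.pi).indicator (hk a) with hk'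
  have hkm : Measurable k := (hk_meas a).indicator measurableSet_Icc
  have hpi := Real.pi_pos
  have hkl : ∫⁻ t, k t < ∞ := by
    rw [hk', lintegral_indicator measurableSet_Icc, setLIntegral_congr Ioc_ae_eq_Icc.symm]
    exact hk_fin0 a h0 h1
  have hle : ∫⁻ t in Ioo (-Real.pi) (3 * Real.pi), hk a t ≤
      ∫⁻ t, (k t + k (-t)) + (k (t - 2 * Real.pi) + k (2 * Real.pi - t)) := by
    rw [← lintegral_indicator measurableSet_Ioo]
    refine lintegral_mono (ind_le fun t ht => ?_)
    by_cases c1 : t ≤ 0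
    · refine le_trans (le_of_eq ?_) (le_add_right (le_add_left le_rfl))
      rw [hk', indicator_of_mem (by exact ⟨by linarith, by linarith [ht.1]⟩), hk_neg]
    by_cases c2 : t ≤ Real.pi
    · refine le_trans (le_of_eq ?_) (le_add_right (le_add_right le_rfl))
      rw [hk', indicator_of_mem (by exact ⟨by linarith, by linarith [ht.1]⟩)]
    by_cases c3 : t ≤ 2 * Real.pi
    · refine le_trans (le_of_eq ?_) (le_add_left (le_add_left le_rfl))
      rw [hk', indicator_of_mem (by exact ⟨by linarith, by linarith [ht.1]⟩), ← hk_neg a (2 * Real.pi - t), neg_sub, hk_sub]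
    · refine le_trans (le_of_eq ?_) (le_add_left (le_add_right le_rfl))
      rw [hk', indicator_of_mem (by exact ⟨by linarith, by linarith [ht.2]⟩), hk_sub]
  refine hle.trans_lt ?_
  rw [lintegral_add_left (by fun_prop), lintegral_add_left (by fun_prop),
    lintegral_add_left (by fun_prop), lintegral_sub_left_eq_self k,
    lintegral_sub_right_eq_self k, lintegral_neg_eq_self k]
  simp [hkl]

theorem hk_fin1 (a θ : ℝ) (h : θ ∈ Ioo (-Real.pi) Real.pi) :
    ∫⁻ s in Ioc 0 (2 * Real.pi), hk a (s - θ) ≤ ∫⁻ t in Ioo (-Real.pi) (3 * Real.pi), hk a t := by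
  rw [← lintegral_indicator measurableSet_Ioo, ← lintegral_sub_right_eq_self (μ := volume) ((Ioo (-Real.pi) (3 * Real.pi)).indicator (hk a)) θ,
    ← lintegral_indicator measurableSet_Ioc]
  refine lintegral_mono (ind_le fun t ht => ?_)
  rw [indicator_of_mem (by exact ⟨by linarith [ht.1, h.2], by linarith [ht.2, h.1]⟩)]

theorem hk_fin2 (a s : ℝ) (h : s ∈ Ioc 0 (2 * Real.pi)) :
    ∫⁻ θ in Ioo (-Real.pi) Real.pi, hk a (s - θ) ≤ ∫⁻ t in Ioo (-Real.pi) (3 * Real.pi), hk a t := by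
  rw [← lintegral_indicator measurableSet_Ioo, ← lintegral_indicator measurableSet_Ioo,
    ← lintegral_sub_left_eq_self (μ := volume) ((Ioo (-Real.pi) (3 * Real.pi)).indicator (hk a)) s]
  refine lintegral_mono (ind_le fun t ht => ?_)
  rw [indicator_of_mem (by exact ⟨by linarith [ht.2, h.1], by linarith [ht.1, h.2]⟩)]

/-- pointwise kernel bound -/
theorem kern (ρ θ s b : ℝ) (h0 : 0 < ρ) (h1 : ρ < 1) (b0 : 0 ≤ b) (b1 : b ≤ 1) :
    (ENNReal.ofReal ‖circleMap 0 1 s - ρ * (Real.cos θ + Real.sin θ * Complex.I)‖)⁻¹ ≤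
      (ENNReal.ofReal (1 - ρ))⁻¹ ^ b * hk (1 - b) (s - θ) := by
  have e1 := L1b ρ θ s h0.le
  have e2 := L1a ρ (ρ * (Real.cos θ + Real.sin θ * Complex.I)) (by
    have := Complex.norm_polarCoord_symm (ρ, θ)
    rw [Complex.polarCoord_symm_apply] at this
    rw [this, abs_of_pos h0]) s
  set x := ‖circleMap 0 1 s - ρ * (Real.cos θ + Real.sin θ * Complex.I)‖
  have hx : 0 < x := by linarith
  have : (ENNReal.ofReal x)⁻¹ = (ENNReal.ofReal x)⁻¹ ^ b * (ENNReal.ofReal x)⁻¹ ^ (1 - b) := by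
    rw [← ENNReal.rpow_add _ _ (by simp) (by simp [hx])]
    simp
  rw [this]
  unfold hk
  gcongr

theorem L3 (p : ℝ) (hp : 1 < p) : ∃ C : ℝ≥0∞, C ≠ ∞ ∧ ∀ ψ : ℝ → ℝ≥0∞, Measurable ψ →
    ∀ D : ℂ → ℝ≥0∞, (∀ z ∈ ball (0:ℂ) 1,
      D z ≤ ∫⁻ s in Ioc 0 (2 * Real.pi), ψ s * (ENNReal.ofReal ‖circleMap 0 1 s - z‖)⁻¹) →
    ∫⁻ z in ball (0:ℂ) 1, D z ^ 2 ≤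
      C * ((∫⁻ s in Ioc 0 (2 * Real.pi), ψ s ^ p) ^ (1 / p)) ^ 2 := by
  set τ := 1 / p with hτ
  have τ0 : 0 < τ := by positivity
  have τ1 : τ < 1 := by rw [hτ, div_lt_one (by linarith)]; exact hp
  set q := p.conjExponent with hq
  have hpq : p.HolderConjugate q := Real.HolderConjugate.conjExponent hp
  have hq0 : 0 < q := hpq.symm.pos
  have hqi : 1 / q = 1 - τ := by
    have := hpq.inv_add_inv_eq_one
    rw [hτ]; simp only [one_div]; linarith
  set β := (2 * τ + 1) / 3 with hβ
  set β' := (1 - τ) / 3 with hβ'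
  set H1 := ∫⁻ t in Ioo (-Real.pi) (3 * Real.pi), hk ((1 - β) * q) t with hH1
  set H2 := ∫⁻ t in Ioo (-Real.pi) (3 * Real.pi), hk (1 - β') t with hH2
  have f1 : H1 < ∞ := hk_fin _ (mul_nonneg (by linarith) hq0.le) (by
    have : (1 - β) * q < (1/q) * q := by
      gcongr; rw [hqi]; linarith
    rwa [one_div, inv_mul_cancel₀ hq0.ne'] at this)
  have f2 : H2 < ∞ := hk_fin _ (by linarith) (by linarith)
  set R := ∫⁻ ρ in Ioo (0:ℝ) 1, (ENNReal.ofReal (1 - ρ))⁻¹ ^ (β + β') with hR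
  have f3 : R < ∞ := by
    refine lt_of_le_of_lt ?_ (pow_inv_fin (β + β') 1 (by linarith) zero_le_one)
    rw [hR, ← lintegral_indicator measurableSet_Ioo, ← lintegral_indicator measurableSet_Ioc,
      ← lintegral_sub_left_eq_self (μ := volume)
        ((Ioc (0:ℝ) 1).indicator fun t => (ENNReal.ofReal t)⁻¹ ^ (β + β')) (1:ℝ)]
    refine lintegral_mono (ind_le fun t ht => ?_)
    rw [indicator_of_mem (by exact ⟨by linarith [ht.2], by linarith [ht.1]⟩)]
  set V := (∫⁻ s in Ioc 0 (2 * Real.pi), (1:ℝ≥0∞) ^ q) ^ (1 / q) with hV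
  have f4 : V < ∞ := by
    rw [hV]
    refine ENNReal.rpow_lt_top_of_nonneg (by positivity) ?_
    simp [ENNReal.mul_eq_top]
  refine ⟨H1 ^ (1 / q) * R * (V * H2), ?_, ?_⟩
  · have := ENNReal.rpow_lt_top_of_nonneg (y := 1 / q) (by positivity) f1.ne
    exact (ENNReal.mul_lt_top (ENNReal.mul_lt_top this f3) (ENNReal.mul_lt_top f4 f2)).ne
  intro ψ hψ D hD
  set N := (∫⁻ s in Ioc 0 (2 * Real.pi), ψ s ^ p) ^ (1 / p) with hN
  have hψ1 : ∫⁻ s in Ioc 0 (2 * Real.pi), ψ s ≤ N * V := by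
    have := ENNReal.lintegral_mul_le_Lp_mul_Lq (volume.restrict (Ioc 0 (2 * Real.pi))) hpq
      (f := ψ) (g := fun _ => 1) hψ.aemeasurable aemeasurable_const
    simpa only [Pi.mul_apply, mul_one] using this
  set W : ℝ → ℝ≥0∞ := fun θ => ∫⁻ s in Ioc 0 (2 * Real.pi), ψ s * hk (1 - β') (s - θ) with hW
  have hWm : Measurable W := by
    have hm := hk_meas (1 - β')
    exact Measurable.lintegral_prod_left' (f := fun x : ℝ × ℝ => ψ x.1 * hk (1 - β') (x.1 - x.2))
      (by fun_prop)
  have hWi : ∫⁻ θ in Ioo (-Real.pi) Real.pi, W θ ≤ N * V * H2 := by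
    have hm := hk_meas (1 - β')
    rw [hW, lintegral_lintegral_swap (by fun_prop)]
    calc _ ≤ ∫⁻ s in Ioc 0 (2 * Real.pi), ψ s * H2 := by
          refine setLIntegral_mono (by fun_prop) fun s hs => ?_
          rw [lintegral_const_mul _ (by fun_prop)]
          gcongr
          exact hk_fin2 _ s hs
      _ = (∫⁻ s in Ioc 0 (2 * Real.pi), ψ s) * H2 := lintegral_mul_const _ hψ
      _ ≤ _ := by gcongr
  have key : ∀ ρ ∈ Ioo (0:ℝ) 1, ∀ θ ∈ Ioo (-Real.pi) Real.pi,
      D (ρ * (Real.cos θ + Real.sin θ * Complex.I)) ^ 2 ≤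
        (N * H1 ^ (1/q) * (ENNReal.ofReal (1 - ρ))⁻¹ ^ (β + β')) * W θ := by
    intro ρ hρ θ hθ
    have hz : (ρ * (Real.cos θ + Real.sin θ * Complex.I) : ℂ) ∈ ball (0:ℂ) 1 := by
      have := Complex.norm_polarCoord_symm (ρ, θ)
      rw [Complex.polarCoord_symm_apply] at this
      rw [mem_ball_zero_iff, this, abs_of_pos hρ.1]
      exact hρ.2
    have hDz := hD _ hz
    have hb : ∀ b, 0 ≤ b → b ≤ 1 → D (ρ * (Real.cos θ + Real.sin θ * Complex.I)) ≤
        (ENNReal.ofReal (1 - ρ))⁻¹ ^ b * ∫⁻ s in Ioc 0 (2 * Real.pi), ψ s * hk (1 - b) (s - θ) := by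
      intro b b0 b1
      have hm := hk_meas (1 - b)
      rw [← lintegral_const_mul _ (by fun_prop)]
      refine hDz.trans (lintegral_mono fun s => ?_)
      rw [mul_left_comm]
      gcongr
      exact kern ρ θ s b hρ.1 hρ.2 b0 b1
    have e1 : D (ρ * (Real.cos θ + Real.sin θ * Complex.I)) ≤
        (ENNReal.ofReal (1 - ρ))⁻¹ ^ β * (N * H1 ^ (1/q)) := by
      refine (hb β (by linarith) (by linarith)).trans ?_
      have hm := hk_meas (1 - β)
      have := ENNReal.lintegral_mul_le_Lp_mul_Lq (volume.restrict (Ioc 0 (2 * Real.pi))) hpq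
        (f := ψ) (g := fun s => hk (1 - β) (s - θ)) hψ.aemeasurable (by fun_prop)
      gcongr
      refine this.trans ?_
      gcongr
      refine le_trans (le_of_eq ?_) (hk_fin1 ((1 - β) * q) θ hθ)
      refine lintegral_congr fun s => ?_
      unfold hk
      rw [ENNReal.rpow_mul]
    have e2 := hb β' (by linarith) (by linarith)
    rw [sq]
    refine (mul_le_mul' e1 e2).trans (le_of_eq ?_)
    rw [ENNReal.rpow_add _ _ (by simp) (by simp [hρ.2])]
    ring
  rw [← lintegral_indicator measurableSet_ball, ← Complex.lintegral_comp_polarCoord_symm]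
  have step : ∫⁻ x in polarCoord.target, ENNReal.ofReal x.1 •
      (ball (0:ℂ) 1).indicator (fun z => D z ^ 2) (Complex.polarCoord.symm x) ≤
      ∫⁻ x in (Ioo (0:ℝ) 1) ×ˢ (Ioo (-Real.pi) Real.pi),
        (N * H1 ^ (1/q) * (ENNReal.ofReal (1 - x.1))⁻¹ ^ (β + β')) * W x.2 := by
    rw [← lintegral_indicator (measurableSet_Ioo.prod measurableSet_Ioo),
      ← lintegral_indicator polarCoord.open_target.measurableSet]
    refine lintegral_mono (ind_le fun x hx => ?_)
    rw [polarCoord_target] at hx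
    by_cases hx1 : Complex.polarCoord.symm x ∈ ball (0:ℂ) 1
    · rw [indicator_of_mem hx1]
      have h1 : x.1 < 1 := by
        rw [mem_ball_zero_iff, Complex.norm_polarCoord_symm] at hx1
        exact (le_abs_self _).trans_lt hx1
      rw [indicator_of_mem (show x ∈ Ioo (0:ℝ) 1 ×ˢ Ioo (-Real.pi) Real.pi from ⟨⟨hx.1, h1⟩, hx.2⟩)]
      refine le_trans ?_ (key x.1 ⟨hx.1, h1⟩ x.2 hx.2)
      rw [Complex.polarCoord_symm_apply, smul_eq_mul]
      refine mul_le_of_le_one_left zero_le ?_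
      rw [← ENNReal.ofReal_one]
      exact ENNReal.ofReal_le_ofReal h1.le
    · rw [indicator_of_notMem hx1]
      simp
  refine step.trans ?_
  rw [Measure.volume_eq_prod, ← Measure.prod_restrict, lintegral_prod_mul
    (f := fun ρ => N * H1 ^ (1/q) * (ENNReal.ofReal (1 - ρ))⁻¹ ^ (β + β')) (g := W)
    (by fun_prop) hWm.aemeasurable, lintegral_const_mul _ (by fun_prop), ← hR]
  calc _ ≤ N * H1 ^ (1 / q) * R * (N * V * H2) := by gcongr
    _ = _ := by ring

open InnerProductSpace in
theorem core (p : ℝ) (hp : 1 < p) : ∃ C : ℝ≥0∞, C ≠ ∞ ∧ ∀ G : ℂ → ℝ,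
    HarmonicContOnCl G (ball 0 1) →
    (∀ s, DifferentiableAt ℝ (fun s => G (circleMap 0 1 s)) s) →
    ∫⁻ s in Ioc 0 (2 * Real.pi), ‖deriv (fun s => G (circleMap 0 1 s)) s‖ₑ ^ p ≠ ∞ →
    ∫⁻ z in ball (0:ℂ) 1, ‖fderiv ℝ G z‖ₑ ^ 2 ≤
      C * ((∫⁻ s in Ioc 0 (2 * Real.pi),
        ‖deriv (fun s => G (circleMap 0 1 s)) s‖ₑ ^ p) ^ (1 / p)) ^ 2 := by
  obtain ⟨C, hC, h⟩ := L3 p hp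
  refine ⟨C, hC, fun G hG hd hf => ?_⟩
  set φ' := deriv (fun s => G (circleMap 0 1 s)) with hφ'
  have hm : Measurable φ' := measurable_deriv _
  refine h (fun s => ‖φ' s‖ₑ) hm.enorm _ fun z hz => ?_
  have hi : IntegrableOn φ' (Ioc 0 (2 * Real.pi)) := by
    have : MemLp φ' (ENNReal.ofReal p) (volume.restrict (Ioc 0 (2 * Real.pi))) := by
      refine ⟨hm.aestronglyMeasurable, ?_⟩
      rw [eLpNorm_lt_top_iff_lintegral_rpow_enorm_lt_top (by simp; linarith) (by simp),
        ENNReal.toReal_ofReal (by linarith)]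
      exact lt_top_iff_ne_top.2 hf
    exact this.integrable (by simp [hp.le])
  have hpi : (0:ℝ) ≤ 2 * Real.pi := by positivity
  have hii : IntervalIntegrable φ' volume 0 (2 * Real.pi) :=
    (intervalIntegrable_iff_integrableOn_Ioc_of_le hpi).2 hi
  have h2 := L2 G hG φ' (fun s => (hd s).hasDerivAt) hii z hz
  have hne : ∀ s, circleMap 0 1 s - z ≠ 0 := fun s => sub_ne_zero.2 (circleMap_ne_mem_ball hz s)
  rw [intervalIntegral.integral_of_le hpi] at h2
  rw [← ofReal_norm]
  refine (ENNReal.ofReal_le_ofReal h2).trans ?_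
  rw [ofReal_integral_eq_lintegral_ofReal]
  · refine lintegral_mono fun s => ?_
    simp only
    rw [ENNReal.ofReal_mul (abs_nonneg _), ENNReal.ofReal_inv_of_pos (norm_pos_iff.2 (hne s)),
      ← ofReal_norm, Real.norm_eq_abs]
  · have hc : Continuous fun s : ℝ => ‖circleMap 0 1 s - z‖⁻¹ :=
      Continuous.inv₀ (by fun_prop) fun s => norm_ne_zero_iff.2 (hne s)
    have := (hii.abs).mul_continuousOn hc.continuousOn
    exact (intervalIntegrable_iff_integrableOn_Ioc_of_le hpi).1 this
  · exact ae_of_all _ fun s => by positivity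

noncomputable def eE : ℂ ≃ₗᵢ[ℝ] EuclideanSpace ℝ (Fin 2) := Complex.orthonormalBasisOneI.repr

noncomputable def gam (x₀ : EuclideanSpace ℝ (Fin 2)) (r : ℝ) (s : ℝ) : EuclideanSpace ℝ (Fin 2) :=
  x₀ + r • eE (circleMap 0 1 s)

theorem gam_cont (x₀ : EuclideanSpace ℝ (Fin 2)) (r : ℝ) : Continuous (gam x₀ r) := by
  unfold gam; fun_prop

theorem gam_mem (x₀ : EuclideanSpace ℝ (Fin 2)) (r : ℝ) (hr : 0 < r) (s : ℝ) :
    gam x₀ r s ∈ sphere x₀ r := by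
  simp [gam, norm_smul, abs_of_pos hr]

theorem gam_anti (x₀ : EuclideanSpace ℝ (Fin 2)) (r : ℝ) (hr : 0 < r) (s t : ℝ)
    (h : |s - t| ≤ Real.pi) : |s - t| ≤ (Real.pi / r) * dist (gam x₀ r s) (gam x₀ r t) := by
  have h1 := L1b 1 t s zero_le_one
  have h2 := Real.mul_abs_le_abs_sin (x := (s - t) / 2) (by
    rw [abs_div, abs_two]; linarith)
  have h3 : ((1:ℝ):ℂ) * (Real.cos t + Real.sin t * Complex.I) = circleMap 0 1 t := by
    rw [circleMap, Complex.exp_mul_I]; simp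
  rw [h3] at h1
  have h4 : dist (gam x₀ r s) (gam x₀ r t) = r * ‖circleMap 0 1 s - circleMap 0 1 t‖ := by
    rw [gam, gam, dist_add_left, dist_smul₀, LinearIsometryEquiv.dist_map, dist_eq_norm,
      Real.norm_of_nonneg hr.le]
  rw [h4]
  rw [abs_div, abs_two] at h2
  have hpi := Real.pi_pos
  have h5 := h2.trans h1
  calc |s - t| = Real.pi * (2 / Real.pi * (|s - t| / 2)) := by field_simp
    _ ≤ Real.pi * ‖circleMap 0 1 s - circleMap 0 1 t‖ := by gcongr
    _ = _ := by field_simp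

theorem gam_half (x₀ : EuclideanSpace ℝ (Fin 2)) (r : ℝ) (hr : 0 < r) (c : ℝ)
    (A : Set (EuclideanSpace ℝ (Fin 2))) :
    volume (Ioc c (c + Real.pi) ∩ gam x₀ r ⁻¹' A) ≤ ENNReal.ofReal (Real.pi / r) * μH[1] A := by
  set f : Ioc c (c + Real.pi) → EuclideanSpace ℝ (Fin 2) := fun x => gam x₀ r x with hf
  have hpi := Real.pi_pos
  have ha : AntilipschitzWith (Real.toNNReal (Real.pi / r)) f := by
    refine AntilipschitzWith.of_le_mul_dist fun x y => ?_
    rw [Real.coe_toNNReal _ (by positivity)]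
    refine gam_anti x₀ r hr x y ?_
    rw [abs_le]
    constructor <;> linarith [x.2.1, x.2.2, y.2.1, y.2.2]
  have h1 := ha.hausdorffMeasure_preimage_le zero_le_one A
  rw [ENNReal.rpow_one, ← (isometry_subtype_coe (s := Ioc c (c + Real.pi))).hausdorffMeasure_image
    (Or.inl zero_le_one), hausdorffMeasure_real] at h1
  refine le_trans (le_of_eq ?_) h1
  congr 1
  ext x
  simp [hf]
  tauto

theorem gam_le (x₀ : EuclideanSpace ℝ (Fin 2)) (r : ℝ) (hr : 0 < r) :
    Measure.map (gam x₀ r) (volume.restrict (Ioc 0 (2 * Real.pi))) ≤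
      (2 * ENNReal.ofReal (Real.pi / r)) • (μH[1]).restrict (sphere x₀ r) := by
  refine Measure.le_iff.2 fun A hA => ?_
  have hpi := Real.pi_pos
  rw [Measure.map_apply (gam_cont x₀ r).measurable hA,
    Measure.restrict_apply ((gam_cont x₀ r).measurable hA), Measure.smul_apply,
    Measure.restrict_apply hA, smul_eq_mul]
  have h1 := gam_half x₀ r hr 0 (A ∩ sphere x₀ r)
  have h2 := gam_half x₀ r hr Real.pi (A ∩ sphere x₀ r)
  calc _ ≤ volume ((Ioc 0 (0 + Real.pi) ∩ gam x₀ r ⁻¹' (A ∩ sphere x₀ r)) ∪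
        (Ioc Real.pi (Real.pi + Real.pi) ∩ gam x₀ r ⁻¹' (A ∩ sphere x₀ r))) := by
        refine measure_mono fun x hx => ?_
        have hs : x ∈ gam x₀ r ⁻¹' (A ∩ sphere x₀ r) := ⟨hx.1, gam_mem x₀ r hr x⟩
        rcases le_or_gt x Real.pi with h | h
        · exact Or.inl ⟨⟨hx.2.1, by linarith⟩, hs⟩
        · exact Or.inr ⟨⟨h, by linarith [hx.2.2]⟩, hs⟩
    _ ≤ _ := measure_union_le _ _
    _ ≤ _ := add_le_add h1 h2
    _ = _ := by ring

theorem L4 (x₀ : EuclideanSpace ℝ (Fin 2)) (r : ℝ) (hr : 0 < r)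
    (f : EuclideanSpace ℝ (Fin 2) → ℝ≥0∞) (hf : AEMeasurable f ((μH[1]).restrict (sphere x₀ r))) :
    ∫⁻ s in Ioc 0 (2 * Real.pi), f (gam x₀ r s) ≤
      2 * ENNReal.ofReal (Real.pi / r) * ∫⁻ y in sphere x₀ r, f y ∂μH[1] := by
  have h := gam_le x₀ r hr
  have hac : Measure.map (gam x₀ r) (volume.restrict (Ioc 0 (2 * Real.pi))) ≪
      (μH[1]).restrict (sphere x₀ r) :=
    (Measure.absolutelyContinuous_of_le h).trans Measure.smul_absolutelyContinuous
  rw [← lintegral_map' (hf.mono_ac hac) (gam_cont x₀ r).aemeasurable]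
  refine (lintegral_mono' h le_rfl).trans ?_
  rw [lintegral_smul_measure, smul_eq_mul]

noncomputable def AA (x₀ : EuclideanSpace ℝ (Fin 2)) (r : ℝ) (w : ℂ) : EuclideanSpace ℝ (Fin 2) :=
  x₀ + r • eE w

noncomputable def LL (r : ℝ) : ℂ →L[ℝ] EuclideanSpace ℝ (Fin 2) :=
  r • (eE.toContinuousLinearEquiv : ℂ →L[ℝ] EuclideanSpace ℝ (Fin 2))

theorem LL_apply (r : ℝ) (w : ℂ) : LL r w = r • eE w := rfl

theorem AA_hasFDerivAt (x₀ : EuclideanSpace ℝ (Fin 2)) (r : ℝ) (w : ℂ) :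
    HasFDerivAt (AA x₀ r) (LL r) w :=
  ((LL r).hasFDerivAt (x := w)).const_add x₀

theorem AA_contDiff (x₀ : EuclideanSpace ℝ (Fin 2)) (r : ℝ) : ContDiff ℝ 2 (AA x₀ r) := by
  have : AA x₀ r = fun w => x₀ + LL r w := rfl
  rw [this]
  exact contDiff_const.add (LL r).contDiff

theorem AA_dist (x₀ : EuclideanSpace ℝ (Fin 2)) (r : ℝ) (hr : 0 < r) (w : ℂ) :
    dist (AA x₀ r w) x₀ = r * ‖w‖ := by
  simp [AA, norm_smul, abs_of_pos hr]

theorem AA_ball (x₀ : EuclideanSpace ℝ (Fin 2)) (r : ℝ) (hr : 0 < r) (w : ℂ) :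
    AA x₀ r w ∈ ball x₀ r ↔ w ∈ ball (0:ℂ) 1 := by
  rw [mem_ball, AA_dist x₀ r hr, mem_ball_zero_iff]
  constructor
  · intro h; by_contra h2; push Not at h2; nlinarith
  · intro h; nlinarith

theorem eE_one : eE 1 = EuclideanSpace.single 0 1 := by
  ext i; fin_cases i <;> simp [eE, Complex.orthonormalBasisOneI_repr_apply]

theorem eE_I : eE Complex.I = EuclideanSpace.single 1 1 := by
  ext i; fin_cases i <;> simp [eE, Complex.orthonormalBasisOneI_repr_apply]

theorem eE_rot (w : ℂ) (r : ℝ) : rot (r • eE w) = r • eE (w * Complex.I) := by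
  ext i; fin_cases i <;> simp [eE, rot, Complex.orthonormalBasisOneI_repr_apply]

theorem integral_AA (x₀ : EuclideanSpace ℝ (Fin 2)) (r : ℝ) (hr : 0 < r)
    (F : EuclideanSpace ℝ (Fin 2) → ℝ) :
    ∫ y in ball x₀ r, F y = ∫ w in ball (0:ℂ) 1, r ^ 2 * F (AA x₀ r w) := by
  rw [← integral_indicator measurableSet_ball, ← integral_indicator measurableSet_ball]
  set H := (ball x₀ r).indicator F with hH
  rw [← integral_add_left_eq_self H x₀]
  have h1 := Measure.integral_comp_smul (volume : Measure (EuclideanSpace ℝ (Fin 2)))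
    (fun y => H (x₀ + y)) r
  have h2 : ∫ w : ℂ, H (AA x₀ r w) = ∫ y, H (x₀ + r • y) :=
    (Complex.orthonormalBasisOneI.measurePreserving_repr).integral_comp
      (eE.toHomeomorph.measurableEmbedding) (fun y => H (x₀ + r • y))
  have h3 : (ball (0:ℂ) 1).indicator (fun w => r ^ 2 * F (AA x₀ r w)) =
      fun w => r ^ 2 * H (AA x₀ r w) := by
    ext w
    by_cases hw : w ∈ ball (0:ℂ) 1
    · rw [indicator_of_mem hw, hH, indicator_of_mem ((AA_ball x₀ r hr w).2 hw)]
    · rw [indicator_of_notMem hw, hH, indicator_of_notMem (fun h => hw ((AA_ball x₀ r hr w).1 h)),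
        mul_zero]
  rw [h3, integral_const_mul, h2, h1]
  simp only [finrank_euclideanSpace_fin, smul_eq_mul]
  rw [abs_of_pos (by positivity)]
  field_simp

open InnerProductSpace in
theorem harm (x₀ : EuclideanSpace ℝ (Fin 2)) (r : ℝ) (hr : 0 < r)
    (g : EuclideanSpace ℝ (Fin 2) → EuclideanSpace ℝ (Fin 2))
    (hc : ContinuousOn g (closedBall x₀ r)) (hd : ContDiffOn ℝ 2 g (ball x₀ r))
    (hl : ∀ y ∈ ball x₀ r, lap g y = 0) :
    HarmonicContOnCl (fun w => g (AA x₀ r w)) (ball 0 1) := by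
  refine HarmonicContOnCl.mk_ball ?_ ?_
  · intro w hw
    have hat : ∀ w ∈ ball (0:ℂ) 1, ContDiffAt ℝ 2 g (AA x₀ r w) := fun w hw =>
      hd.contDiffAt (isOpen_ball.mem_nhds ((AA_ball x₀ r hr w).2 hw))
    refine ⟨(hat w hw).comp w (AA_contDiff x₀ r).contDiffAt, ?_⟩
    have hfd : ∀ w ∈ ball (0:ℂ) 1, fderiv ℝ (fun w => g (AA x₀ r w)) w =
        (fderiv ℝ g (AA x₀ r w)).comp (LL r) := fun w hw =>
      (((hat w hw).differentiableAt (by norm_num)).hasFDerivAt.comp w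
        (AA_hasFDerivAt x₀ r w)).fderiv
    filter_upwards [isOpen_ball.mem_nhds hw] with z hz
    have hdd : DifferentiableAt ℝ (fderiv ℝ g) (AA x₀ r z) :=
      ((hat z hz).fderiv_right (m := 1) (by norm_num)).differentiableAt (by norm_num)
    have h2 : ∀ v : ℂ, iteratedFDeriv ℝ 2 (fun w => g (AA x₀ r w)) z ![v, v] =
        fderiv ℝ (fun y => fderiv ℝ g y (LL r v)) (AA x₀ r z) (LL r v) := by
      intro v
      rw [iteratedFDeriv_two_apply]
      simp only [Matrix.cons_val_zero, Matrix.cons_val_one]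
      have e1 : fderiv ℝ (fun w => g (AA x₀ r w)) =ᶠ[nhds z]
          fun w => (fderiv ℝ g (AA x₀ r w)).comp (LL r) := by
        filter_upwards [isOpen_ball.mem_nhds hz] with w hw using hfd w hw
      have e2 : HasFDerivAt (fun w => fderiv ℝ g (AA x₀ r w))
          ((fderiv ℝ (fderiv ℝ g) (AA x₀ r z)).comp (LL r)) z :=
        hdd.hasFDerivAt.comp z (AA_hasFDerivAt x₀ r z)
      have e3 := e2.clm_comp (hasFDerivAt_const (LL r) z)
      have e4 := hdd.hasFDerivAt.clm_apply (hasFDerivAt_const (LL r v) (AA x₀ r z))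
      rw [e1.fderiv_eq, e3.fderiv, e4.fderiv]
      simp
    rw [laplacian_eq_iteratedFDeriv_complexPlane]
    simp only [h2, Pi.zero_apply, LL_apply, eE_one, eE_I]
    have h3 := hl _ ((AA_ball x₀ r hr z).2 hz)
    rw [lap, Fin.sum_univ_two] at h3
    have h4 : ∀ v, fderiv ℝ (fun y => fderiv ℝ g y (r • v)) (AA x₀ r z) (r • v) =
        r ^ 2 • fderiv ℝ (fun y => fderiv ℝ g y v) (AA x₀ r z) v := by
      intro v
      have e4 := hdd.hasFDerivAt.clm_apply (hasFDerivAt_const v (AA x₀ r z))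
      have e5 := hdd.hasFDerivAt.clm_apply (hasFDerivAt_const (r • v) (AA x₀ r z))
      rw [e4.fderiv, e5.fderiv]
      simp [smul_smul, sq]
    rw [h4, h4, ← smul_add, h3, smul_zero]
  · refine hc.comp (AA_contDiff x₀ r).continuous.continuousOn fun w hw => ?_
    rw [mem_closedBall, AA_dist x₀ r hr]
    rw [mem_closedBall_zero_iff] at hw
    nlinarith

theorem opn (T : ℂ →L[ℝ] EuclideanSpace ℝ (Fin 2)) :
    ‖T‖ ^ 2 ≤ ∑ j, ‖(EuclideanSpace.proj j : EuclideanSpace ℝ (Fin 2) →L[ℝ] ℝ).comp T‖ ^ 2 := by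
  rw [← Real.le_sqrt (norm_nonneg _) (Finset.sum_nonneg fun _ _ => sq_nonneg _)]
  refine T.opNorm_le_bound (Real.sqrt_nonneg _) fun v => ?_
  rw [EuclideanSpace.norm_eq, ← Real.sqrt_sq (norm_nonneg v), ← Real.sqrt_mul
    (Finset.sum_nonneg fun _ _ => sq_nonneg _)]
  refine Real.sqrt_le_sqrt ?_
  rw [Finset.sum_mul]
  refine Finset.sum_le_sum fun j _ => ?_
  rw [← mul_pow]
  gcongr
  exact ((EuclideanSpace.proj j : EuclideanSpace ℝ (Fin 2) →L[ℝ] ℝ).comp T).le_opNorm v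

theorem dbound (x₀ : EuclideanSpace ℝ (Fin 2)) (r : ℝ) (hr : 0 < r)
    (g : EuclideanSpace ℝ (Fin 2) → EuclideanSpace ℝ (Fin 2)) (w : ℂ)
    (hd : DifferentiableAt ℝ g (AA x₀ r w)) :
    r ^ 2 * ‖fderiv ℝ g (AA x₀ r w)‖ ^ 2 ≤ ∑ j, ‖fderiv ℝ (fun w => g (AA x₀ r w) j) w‖ ^ 2 := by
  have h1 := hd.hasFDerivAt.comp w (AA_hasFDerivAt x₀ r w)
  have h2 : ∀ j, fderiv ℝ (fun w => g (AA x₀ r w) j) w =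
      (EuclideanSpace.proj j : EuclideanSpace ℝ (Fin 2) →L[ℝ] ℝ).comp
        ((fderiv ℝ g (AA x₀ r w)).comp (LL r)) := fun j =>
    (((EuclideanSpace.proj j : EuclideanSpace ℝ (Fin 2) →L[ℝ] ℝ).hasFDerivAt).comp w h1).fderiv
  simp only [h2]
  refine le_trans ?_ (opn _)
  rw [← mul_pow]
  gcongr
  rw [← le_div_iff₀' hr]
  refine ContinuousLinearMap.opNorm_le_bound _ (by positivity) fun v => ?_
  have h3 := ((fderiv ℝ g (AA x₀ r w)).comp (LL r)).le_opNorm (r⁻¹ • eE.symm v)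
  have h4 : LL r (r⁻¹ • eE.symm v) = v := by
    rw [LL_apply, map_smul, smul_smul, mul_inv_cancel₀ hr.ne', one_smul,
      LinearIsometryEquiv.apply_symm_apply]
  rw [ContinuousLinearMap.comp_apply, h4, norm_smul, LinearIsometryEquiv.norm_map, norm_inv,
    Real.norm_of_nonneg hr.le] at h3
  refine h3.trans (le_of_eq ?_)
  field_simp

theorem dphi (x₀ : EuclideanSpace ℝ (Fin 2)) (r : ℝ) (hr : 0 < r)
    (u g : EuclideanSpace ℝ (Fin 2) → EuclideanSpace ℝ (Fin 2))
    (hu : ∀ y ∈ sphere x₀ r, DifferentiableAt ℝ u y) (he : EqOn g u (sphere x₀ r)) (j : Fin 2)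
    (s : ℝ) : HasDerivAt (fun s => g (AA x₀ r (circleMap 0 1 s)) j)
      ((r • fderiv ℝ u (gam x₀ r s) (tangent x₀ r (gam x₀ r s))) j) s := by
  have h0 : (fun s => g (AA x₀ r (circleMap 0 1 s)) j) = fun s => u (gam x₀ r s) j := by
    ext s
    rw [← he (gam_mem x₀ r hr s)]; rfl
  rw [h0]
  have h1 : HasDerivAt (gam x₀ r) (LL r (circleMap 0 1 s * Complex.I)) s :=
    (AA_hasFDerivAt x₀ r (circleMap 0 1 s)).comp_hasDerivAt s (hasDerivAt_circleMap 0 1 s)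
  have h2 := (hu _ (gam_mem x₀ r hr s)).hasFDerivAt.comp_hasDerivAt s h1
  have h3 := ((EuclideanSpace.proj j : EuclideanSpace ℝ (Fin 2) →L[ℝ] ℝ).hasFDerivAt).comp_hasDerivAt s h2
  have h4 : LL r (circleMap 0 1 s * Complex.I) = r • tangent x₀ r (gam x₀ r s) := by
    rw [tangent, smul_smul, mul_one_div_cancel hr.ne', one_smul, gam, add_sub_cancel_left, eE_rot,
      LL_apply]
  rw [h4, map_smul] at h3
  exact h3

theorem bdry (p : ℝ) (hp : 1 < p) (x₀ : EuclideanSpace ℝ (Fin 2)) (r : ℝ) (hr : 0 < r)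
    (u g : EuclideanSpace ℝ (Fin 2) → EuclideanSpace ℝ (Fin 2))
    (hu : ∀ y ∈ sphere x₀ r, DifferentiableAt ℝ u y)
    (hi : IntegrableOn (fun y => ‖fderiv ℝ u y (tangent x₀ r y)‖ ^ p) (sphere x₀ r) μH[1])
    (he : EqOn g u (sphere x₀ r)) (j : Fin 2) :
    ∫⁻ s in Ioc 0 (2 * Real.pi),
      ‖deriv (fun s => g (AA x₀ r (circleMap 0 1 s)) j) s‖ₑ ^ p ≤
    ENNReal.ofReal (r ^ p * (2 * (Real.pi / r)) *
      ∫ y in sphere x₀ r, ‖fderiv ℝ u y (tangent x₀ r y)‖ ^ p ∂μH[1]) := by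
  have hpi := Real.pi_pos
  have h1 : ∀ s, ‖deriv (fun s => g (AA x₀ r (circleMap 0 1 s)) j) s‖ₑ ^ p ≤
      ENNReal.ofReal (r ^ p) *
        ENNReal.ofReal (‖fderiv ℝ u (gam x₀ r s) (tangent x₀ r (gam x₀ r s))‖ ^ p) := by
    intro s
    rw [(dphi x₀ r hr u g hu he j s).deriv, ← ENNReal.ofReal_mul (by positivity),
      ← ofReal_norm_eq_enorm, ENNReal.ofReal_rpow_of_nonneg (norm_nonneg _) (by linarith),
      ← Real.mul_rpow hr.le (norm_nonneg _)]
    refine ENNReal.ofReal_le_ofReal (Real.rpow_le_rpow (norm_nonneg _) ?_ (by linarith))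
    refine (PiLp.norm_apply_le _ j).trans (le_of_eq ?_)
    rw [norm_smul, Real.norm_of_nonneg hr.le]
  have h2 := L4 x₀ r hr (fun y => ENNReal.ofReal (‖fderiv ℝ u y (tangent x₀ r y)‖ ^ p))
    hi.aestronglyMeasurable.aemeasurable.ennreal_ofReal
  rw [← ofReal_integral_eq_lintegral_ofReal hi
    (Filter.Eventually.of_forall fun y => by positivity)] at h2
  refine (lintegral_mono h1).trans ?_
  rw [lintegral_const_mul' _ _ ENNReal.ofReal_ne_top, ENNReal.ofReal_mul (by positivity),
    ENNReal.ofReal_mul (by positivity), mul_assoc]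
  refine mul_le_mul_right (h2.trans (le_of_eq ?_)) _
  rw [ENNReal.ofReal_mul (by norm_num)]
  norm_num

theorem inner_bound (x₀ : EuclideanSpace ℝ (Fin 2)) (r : ℝ) (hr : 0 < r)
    (g : EuclideanSpace ℝ (Fin 2) → EuclideanSpace ℝ (Fin 2))
    (hd : ContDiffOn ℝ 2 g (ball x₀ r)) (B : ℝ) (hB : 0 ≤ B)
    (h : ∀ j, ∫⁻ z in ball (0:ℂ) 1, ‖fderiv ℝ (fun w => g (AA x₀ r w) j) z‖ₑ ^ 2 ≤
      ENNReal.ofReal B) :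
    ∫ y in ball x₀ r, ‖fderiv ℝ g y‖ ^ 2 ≤ 2 * B := by
  rw [integral_AA x₀ r hr]
  have hnn : 0 ≤ᵐ[volume.restrict (ball (0:ℂ) 1)]
      fun w => r ^ 2 * ‖fderiv ℝ g (AA x₀ r w)‖ ^ 2 :=
    Filter.Eventually.of_forall fun w => by positivity
  by_cases hint : Integrable (fun w => r ^ 2 * ‖fderiv ℝ g (AA x₀ r w)‖ ^ 2)
      (volume.restrict (ball (0:ℂ) 1))
  swap
  · rw [integral_undef hint]; positivity
  rw [integral_eq_lintegral_of_nonneg_ae hnn hint.aestronglyMeasurable]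
  refine ENNReal.toReal_le_of_le_ofReal (by positivity) ?_
  calc ∫⁻ w in ball (0:ℂ) 1, ENNReal.ofReal (r ^ 2 * ‖fderiv ℝ g (AA x₀ r w)‖ ^ 2)
      ≤ ∫⁻ w in ball (0:ℂ) 1, ∑ j, ‖fderiv ℝ (fun w => g (AA x₀ r w) j) w‖ₑ ^ 2 := by
        refine setLIntegral_mono' measurableSet_ball fun w hw => ?_
        have hd' : DifferentiableAt ℝ g (AA x₀ r w) :=
          (hd.differentiableOn (by norm_num)).differentiableAt
            (isOpen_ball.mem_nhds ((AA_ball x₀ r hr w).2 hw))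
        refine (ENNReal.ofReal_le_ofReal (dbound x₀ r hr g w hd')).trans (le_of_eq ?_)
        rw [ENNReal.ofReal_sum_of_nonneg fun _ _ => sq_nonneg _]
        refine Finset.sum_congr rfl fun j _ => ?_
        rw [ENNReal.ofReal_pow (norm_nonneg _), ofReal_norm_eq_enorm]
    _ = ∑ j, ∫⁻ w in ball (0:ℂ) 1, ‖fderiv ℝ (fun w => g (AA x₀ r w) j) w‖ₑ ^ 2 :=
        lintegral_finsetSum _ fun j _ => (measurable_fderiv ℝ _).enorm.pow_const _
    _ ≤ ∑ j : Fin 2, ENNReal.ofReal B := Finset.sum_le_sum fun j _ => h j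
    _ = ENNReal.ofReal (2 * B) := by
        rw [ENNReal.ofReal_mul (by norm_num)]
        simp

end helpers

theorem stmt11 (p : ℝ) (hp : 1 < p) (hp2 : p ≤ 2) :
    ∃ C > 0, ∀ (x₀ : EuclideanSpace ℝ (Fin 2)) (r : ℝ), 0 < r →
      ∀ u g : EuclideanSpace ℝ (Fin 2) → EuclideanSpace ℝ (Fin 2),
        (∀ y ∈ sphere x₀ r, DifferentiableAt ℝ u y) →
        IntegrableOn (fun y => ‖fderiv ℝ u y (tangent x₀ r y)‖ ^ p) (sphere x₀ r) μH[1] →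
        ContinuousOn g (closedBall x₀ r) →
        ContDiffOn ℝ 2 g (ball x₀ r) →
        (∀ y ∈ ball x₀ r, lap g y = 0) →
        EqOn g u (sphere x₀ r) →
        ∫ y in ball x₀ r, ‖fderiv ℝ g y‖ ^ 2 ≤
          C * r ^ (2 - 2 / p) *
            (∫ y in sphere x₀ r, ‖fderiv ℝ u y (tangent x₀ r y)‖ ^ p ∂μH[1]) ^ (2 / p) := by
  obtain ⟨C, hC, hcore⟩ := core p hp
  have hpi := Real.pi_pos
  refine ⟨2 * C.toReal * (2 * Real.pi) ^ (2 / p) + 1, by positivity, ?_⟩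
  intro x₀ r hr u g hu hi hc hd hl he
  set I := ∫ y in sphere x₀ r, ‖fderiv ℝ u y (tangent x₀ r y)‖ ^ p ∂μH[1] with hI
  have hI0 : 0 ≤ I := integral_nonneg fun y => by positivity
  have hp0 : 0 < p := by linarith
  have key := inner_bound x₀ r hr g hd
    (C.toReal * ((r ^ p * (2 * (Real.pi / r)) * I) ^ (1 / p)) ^ 2) (by positivity) ?_
  · have e1 : ((r ^ p * (2 * (Real.pi / r)) * I) ^ (1 / p)) ^ 2 =
        (2 * Real.pi) ^ (2 / p) * r ^ (2 - 2 / p) * I ^ (2 / p) := by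
      have e0 : r ^ p * (2 * (Real.pi / r)) * I = 2 * Real.pi * r ^ (p - 1) * I := by
        rw [Real.rpow_sub_one hr.ne']; ring
      have e2 : (1 / p) * (2 : ℕ) = 2 / p := by push_cast; ring
      rw [e0, ← Real.rpow_mul_natCast (by positivity), e2,
        Real.mul_rpow (by positivity) hI0, Real.mul_rpow (by positivity) (by positivity),
        ← Real.rpow_mul hr.le]
      congr 3
      field_simp
    rw [e1] at key
    refine key.trans ?_
    have : 0 ≤ r ^ (2 - 2 / p) * I ^ (2 / p) := by positivity
    nlinarith
  · intro j
    have hb := bdry p hp x₀ r hr u g hu hi he j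
    have h1 := hcore (fun w => g (AA x₀ r w) j)
      ((harm x₀ r hr g hc hd hl).comp_CLM (EuclideanSpace.proj j))
      (fun s => (dphi x₀ r hr u g hu he j s).differentiableAt)
      (ne_top_of_le_ne_top ENNReal.ofReal_ne_top hb)
    refine h1.trans ?_
    rw [ENNReal.ofReal_mul ENNReal.toReal_nonneg, ENNReal.ofReal_toReal hC,
      ENNReal.ofReal_pow (by positivity),
      ← ENNReal.ofReal_rpow_of_nonneg (by positivity) (by positivity)]
    gcongr
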